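/- Let K = ℚ_p(θ) where θ is a root of unity of order coprime to p, with [K : ℚ_p] = n, and let F be the minimal polynomial of θ over ℚ_p. Then 1, θ, …, θ^{n−1} is an orthogonal basis of K over ℚ_p if and only if F is irreducible modulo p. -/

import Mathlib

open IntermediateField

namespace PadicInt

open Polynomial

variable {p : ℕ} [Fact p.Prime] {K : Type*} [NormedField K] [NormedAlgebra ℚ_[p] K]

/-- Evaluation of polynomials with `p`-adic integer coefficients at a point of a normed field
over `ℚ_[p]`. -/
noncomputable def evalHom (θ : K) : ℤ_[p][X] →+* K :=
  eval₂RingHom ((algebraMap ℚ_[p] K).comp (algebraMap ℤ_[p] ℚ_[p])) θ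

theorem evalHom_apply (θ : K) (P : ℤ_[p][X]) :
    evalHom θ P = aeval θ (P.map (algebraMap ℤ_[p] ℚ_[p])) := by
  simp [evalHom, aeval_def, eval₂_map]

theorem evalHom_eq_sum_fin (θ : K) {P : ℤ_[p][X]} {n : ℕ} (h : P.natDegree < n) :
    evalHom θ P = ∑ i : Fin n, (P.coeff i : ℚ_[p]) • θ ^ (i : ℕ) := by
  rw [Fin.sum_univ_eq_sum_range (fun i => (P.coeff i : ℚ_[p]) • θ ^ i) n]
  simp only [evalHom, coe_eval₂RingHom, eval₂_eq_sum_range' _ h, Algebra.smul_def]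
  rfl

theorem norm_evalHom_le_one [IsUltrametricDist K] {θ : K} (hθ : ‖θ‖ = 1) (P : ℤ_[p][X]) :
    ‖evalHom θ P‖ ≤ 1 := by
  rw [evalHom_eq_sum_fin θ P.natDegree.lt_succ_self]
  refine IsUltrametricDist.norm_sum_le_of_forall_le_of_nonneg zero_le_one fun i _ => ?_
  rw [norm_smul, norm_pow, hθ, one_pow, mul_one]
  exact (P.coeff i).2

theorem exists_eq_C_mul_of_map_toZMod_eq_zero {P : ℤ_[p][X]}
    (h : P.map (toZMod (p := p)) = 0) : ∃ E, P = C (p : ℤ_[p]) * E := by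
  refine C_dvd_iff_dvd_coeff _ _ |>.2 fun i => ?_
  rw [← Ideal.mem_span_singleton, ← maximalIdeal_eq_span_p, ← ker_toZMod, RingHom.mem_ker,
    ← coeff_map, h, coeff_zero]

theorem norm_evalHom_lt_one_of_map_toZMod_eq_zero [IsUltrametricDist K] {θ : K} (hθ : ‖θ‖ = 1)
    {P : ℤ_[p][X]} (h : P.map (toZMod (p := p)) = 0) : ‖evalHom θ P‖ < 1 := by
  obtain ⟨E, rfl⟩ := exists_eq_C_mul_of_map_toZMod_eq_zero h
  have hp : ‖evalHom θ (C (p : ℤ_[p]))‖ < 1 := by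
    have : evalHom θ (C (p : ℤ_[p])) = algebraMap ℚ_[p] K p := by simp [evalHom]
    rw [this, norm_algebraMap']
    exact Padic.norm_p_lt_one
  rw [map_mul, norm_mul]
  exact mul_lt_one_of_nonneg_of_lt_one_left (norm_nonneg _) hp (norm_evalHom_le_one hθ E)

theorem norm_evalHom_eq_one_of_isCoprime [IsUltrametricDist K] {θ : K} (hθ : ‖θ‖ = 1)
    {F G : ℤ_[p][X]} (hF : evalHom θ F = 0)
    (h : IsCoprime (F.map (toZMod (p := p))) (G.map (toZMod (p := p)))) :
    ‖evalHom θ G‖ = 1 := by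
  obtain ⟨u, v, huv⟩ := h
  have hs := map_surjective (toZMod (p := p)) (ZMod.ringHom_surjective _)
  obtain ⟨U, rfl⟩ := hs u
  obtain ⟨V, rfl⟩ := hs v
  have key : ‖evalHom θ (U * F + V * G - 1)‖ < 1 :=
    norm_evalHom_lt_one_of_map_toZMod_eq_zero hθ (by simp [huv])
  refine le_antisymm (norm_evalHom_le_one hθ G) (not_lt.1 fun hG => ?_)
  have hVG : ‖evalHom θ V * evalHom θ G‖ < 1 := by
    rw [norm_mul]
    exact mul_lt_one_of_nonneg_of_lt_one_right (norm_evalHom_le_one hθ V) (norm_nonneg _) hG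
  rw [map_sub, map_add, map_mul, map_mul, hF, mul_zero, zero_add, map_one] at key
  have := IsUltrametricDist.norm_add_le_max (evalHom θ V * evalHom θ G)
    (-(evalHom θ V * evalHom θ G - 1))
  rw [← sub_eq_add_neg, sub_sub_cancel, norm_neg, norm_one] at this
  exact absurd this (not_le.2 (max_lt hVG key))

theorem irreducible_map_toZMod_of_orthogonal [IsUltrametricDist K] {θ : K} (hθ : ‖θ‖ = 1)
    {F : ℤ_[p][X]} (hFm : F.Monic) (hF : evalHom θ F = 0)
    (h : ∀ a : Fin F.natDegree → ℚ_[p], ‖∑ i, a i • θ ^ (i : ℕ)‖₊ =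
      Finset.univ.sup fun i => ‖a i • θ ^ (i : ℕ)‖₊) :
    Irreducible (F.map (toZMod (p := p))) := by
  have monic_norm : ∀ G : ℤ_[p][X], G.Monic → G.natDegree < F.natDegree →
      ‖evalHom θ G‖ = 1 := by
    intro G hG hlt
    refine le_antisymm (norm_evalHom_le_one hθ G) ?_
    have hle := Finset.le_sup
      (f := fun i : Fin F.natDegree => ‖(G.coeff i : ℚ_[p]) • θ ^ (i : ℕ)‖₊)
      (Finset.mem_univ ⟨G.natDegree, hlt⟩)
    rw [← h fun i => (G.coeff i : ℚ_[p]), ← evalHom_eq_sum_fin θ hlt, ← NNReal.coe_le_coe] at hle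
    simpa [norm_smul, hθ, hG.coeff_natDegree] using hle
  refine (hFm.map _).irreducible_iff_natDegree'.2 ⟨fun h1 => ?_, fun f g hf hg hfg => ?_⟩
  · have : F.natDegree = 0 := by rw [← hFm.natDegree_map (toZMod (p := p)), h1, natDegree_one]
    rw [hFm.natDegree_eq_zero.1 this, map_one] at hF
    exact one_ne_zero hF
  · intro hne
    rw [Finset.mem_Ioc, hFm.natDegree_map] at hne
    have hs := map_surjective (toZMod (p := p)) (ZMod.ringHom_surjective _)
    obtain ⟨G, rfl, hGd, hG⟩ := lifts_and_natDegree_eq_and_monic ((mem_lifts f).2 (hs f)) hf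
    obtain ⟨H, rfl, hHd, hH⟩ := lifts_and_natDegree_eq_and_monic ((mem_lifts g).2 (hs g)) hg
    have hdeg : G.natDegree + H.natDegree = F.natDegree := by
      rw [hGd, hHd, ← hf.natDegree_mul hg, hfg, hFm.natDegree_map]
    have key : ‖evalHom θ (G * H - F)‖ < 1 :=
      norm_evalHom_lt_one_of_map_toZMod_eq_zero hθ (by simp [hfg])
    rw [map_sub, hF, sub_zero, map_mul, norm_mul, monic_norm G hG (by omega),
      monic_norm H hH (by omega), one_mul] at key
    exact lt_irrefl _ key

theorem orthogonal_of_irreducible_map_toZMod [IsUltrametricDist K] {θ : K} (hθ : ‖θ‖ = 1)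
    {F : ℤ_[p][X]} (hFm : F.Monic) (hF : evalHom θ F = 0)
    (hirr : Irreducible (F.map (toZMod (p := p)))) (a : Fin F.natDegree → ℚ_[p]) :
    ‖∑ i, a i • θ ^ (i : ℕ)‖₊ = Finset.univ.sup fun i => ‖a i • θ ^ (i : ℕ)‖₊ := by
  have hterm : ∀ i, ‖a i • θ ^ (i : ℕ)‖₊ = ‖a i‖₊ := fun i => by
    ext; simp [norm_smul, hθ]
  simp only [hterm]
  have hpos : 0 < F.natDegree := by
    rw [← hFm.natDegree_map (toZMod (p := p))]; exact hirr.natDegree_pos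
  obtain ⟨j, -, hj⟩ := Finset.exists_mem_eq_sup (Finset.univ : Finset (Fin F.natDegree))
    ⟨⟨0, hpos⟩, Finset.mem_univ _⟩ (fun i => ‖a i‖₊)
  have hmax : ∀ i, ‖a i‖ ≤ ‖a j‖ := fun i => by
    have := Finset.le_sup (f := fun i => ‖a i‖₊) (Finset.mem_univ i)
    rw [hj] at this
    exact this
  rw [hj]
  by_cases hc : a j = 0
  · have : ∀ i, a i = 0 := fun i => norm_le_zero_iff.1 (by simpa [hc] using hmax i)
    simp [this]
  have hb : ∀ i, ‖a i / a j‖ ≤ 1 := fun i => by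
    rw [norm_div]; exact div_le_one_of_le₀ (hmax i) (norm_nonneg _)
  let b : Fin F.natDegree → ℤ_[p] := fun i => ⟨a i / a j, hb i⟩
  let G : ℤ_[p][X] := ∑ i, C (b i) * X ^ (i : ℕ)
  have hGdeg : G.degree < F.natDegree := degree_sum_fin_lt b
  have hGj : G.coeff j = 1 := by
    have hbj : b j = 1 := Subtype.ext (div_self hc)
    simp [G, finsetSum_coeff, coeff_C_mul, coeff_X_pow, Fin.val_inj, hbj]
  have hG0 : G.map (toZMod (p := p)) ≠ 0 := fun h0 => by
    have := congrArg (fun P => P.coeff j) h0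
    simp [hGj] at this
  have hcop : IsCoprime (F.map (toZMod (p := p))) (G.map (toZMod (p := p))) := by
    refine (hirr.coprime_iff_not_dvd).2 fun hdvd => ?_
    refine absurd (degree_le_of_dvd hdvd hG0) (not_le.2 ?_)
    rw [degree_eq_natDegree hirr.ne_zero, hFm.natDegree_map]
    exact degree_map_le.trans_lt hGdeg
  have hnorm := norm_evalHom_eq_one_of_isCoprime hθ hF hcop
  have hsum : ∑ i, a i • θ ^ (i : ℕ) = a j • evalHom θ G := by
    have : evalHom θ G = ∑ i, (a i / a j) • θ ^ (i : ℕ) := by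
      simp only [G, map_sum, map_mul, map_pow]
      refine Finset.sum_congr rfl fun i _ => ?_
      rw [Algebra.smul_def]
      simp only [evalHom, coe_eval₂RingHom, eval₂_C, eval₂_X]
      rfl
    rw [this, Finset.smul_sum]
    refine Finset.sum_congr rfl fun i _ => ?_
    rw [smul_smul, mul_div_cancel₀ _ hc]
  ext
  rw [hsum, coe_nnnorm, coe_nnnorm, norm_smul, hnorm, mul_one]

end PadicInt

/-- Let K = ℚ_p(θ) where θ is a root of unity of order q coprime to p, with
[K : ℚ_p] = n, and F the minimal polynomial of θ over ℚ_p (with ℤ_p coefficients). Then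
1, θ, …, θ^{n-1} is an orthogonal basis of K over ℚ_p iff F is irreducible modulo p. -/
theorem stmt13 {p q : ℕ} [Fact p.Prime] (hq : 0 < q) (hqp : Nat.Coprime q p)
    {K : Type*} [NormedField K] [NormedAlgebra ℚ_[p] K] [FiniteDimensional ℚ_[p] K]
    (hna : ∀ x y : K, ‖x + y‖ ≤ max ‖x‖ ‖y‖)
    (hext : ∀ x : ℚ_[p], ‖algebraMap ℚ_[p] K x‖ = ‖x‖)
    (θ : K) (hθ : IsPrimitiveRoot θ q) (hgen : ℚ_[p]⟮θ⟯ = ⊤)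
    {n : ℕ} (hn : Module.finrank ℚ_[p] K = n)
    (F : Polynomial ℤ_[p]) (hFmonic : F.Monic)
    (hF : F.map (algebraMap ℤ_[p] ℚ_[p]) = minpoly ℚ_[p] θ) :
    (∀ a : Fin n → ℚ_[p],
        ‖∑ i, a i • θ ^ (i : ℕ)‖₊ =
          Finset.univ.sup fun i => ‖a i • θ ^ (i : ℕ)‖₊) ↔
      Irreducible (F.map (PadicInt.toZMod (p := p))) := by
  have : IsUltrametricDist K :=
    IsUltrametricDist.isUltrametricDist_of_forall_norm_add_le_max_norm hna
  have hθ1 : ‖θ‖ = 1 := hθ.isOfFinOrder hq.ne' |>.norm_eq_one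
  have hFθ : PadicInt.evalHom θ F = 0 := by
    rw [PadicInt.evalHom_apply, hF, minpoly.aeval]
  have hdeg : F.natDegree = n := by
    rw [← hFmonic.natDegree_map (algebraMap ℤ_[p] ℚ_[p]), hF, ← hn,
      ← IntermediateField.adjoin.finrank (Algebra.IsIntegral.isIntegral θ), hgen,
      IntermediateField.finrank_top']
  subst hdeg
  exact ⟨PadicInt.irreducible_map_toZMod_of_orthogonal hθ1 hFmonic hFθ,
    PadicInt.orthogonal_of_irreducible_map_toZMod hθ1 hFmonic hFθ⟩
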